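/- Let ω̂ = ω + ε v be a pure dual quaternion, i.e. ω and v are quaternions with zero real part, identified with vectors in ℝ³, and suppose ‖ω‖ < 1 and ‖v‖ < 1. Then the sequence of powers ω̂^k converges to the zero dual quaternion as k → ∞. -/

import Mathlib

open Filter

/-- The dual quaternion `a + ε b` with real part `a` and dual part `b`. -/
noncomputable def dq (a b : Quaternion ℝ) : DualNumber (Quaternion ℝ) :=
  TrivSqZeroExt.inl a + TrivSqZeroExt.inr b

/-- The norm `‖a_r + ε a_d‖ = √(‖a_r‖² + ‖a_d‖²)` of a dual quaternion. -/
noncomputable def dualQuatNorm (x : DualNumber (Quaternion ℝ)) : ℝ :=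
  Real.sqrt (‖x.fst‖ ^ 2 + ‖x.snd‖ ^ 2)

theorem dq_pow_fst (ω v : Quaternion ℝ) (k : ℕ) : ((dq ω v) ^ k).fst = ω ^ k := by
  simp [dq, TrivSqZeroExt.fst_pow]

theorem dq_pow_snd_norm (ω v : Quaternion ℝ) (k : ℕ) :
    ‖((dq ω v) ^ (k + 1)).snd‖ ≤ (k + 1) * ‖ω‖ ^ k * ‖v‖ := by
  induction k with
  | zero => simp [dq]
  | succ k ih =>
    have h : ((dq ω v) ^ (k + 1 + 1)).snd = ω ^ (k + 1) * v + ((dq ω v) ^ (k + 1)).snd * ω := by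
      rw [pow_succ, TrivSqZeroExt.snd_mul, dq_pow_fst]
      simp [dq]
    rw [h]
    refine (norm_add_le _ _).trans ?_
    rw [norm_mul, norm_mul, norm_pow]
    have := mul_le_mul_of_nonneg_right ih (norm_nonneg ω)
    push_cast
    calc _ ≤ ‖ω‖ ^ (k + 1) * ‖v‖ + (k + 1) * ‖ω‖ ^ k * ‖v‖ * ‖ω‖ := by gcongr
      _ = _ := by ring

/-- For a pure dual quaternion `ω̂ = ω + ε v` (the quaternions `ω`, `v` have zero
real part, i.e. are vectors in `ℝ³`) with `‖ω‖ < 1` and `‖v‖ < 1`, the powers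
`ω̂^k` converge (in the dual quaternion norm) to the zero dual quaternion as
`k → ∞`. -/
theorem pure_dualQuat_pow_tendsto_zero (ω v : Quaternion ℝ) (hω : ω.re = 0) (hv : v.re = 0)
    (hωn : ‖ω‖ < 1) (hvn : ‖v‖ < 1) :
    Tendsto (fun k : ℕ => dualQuatNorm ((dq ω v) ^ k - 0)) atTop (nhds 0) := by
  have h1 : Tendsto (fun k : ℕ => ‖((dq ω v) ^ (k + 1)).fst‖) atTop (nhds 0) := by
    simp only [dq_pow_fst, norm_pow]
    exact (tendsto_pow_atTop_nhds_zero_of_lt_one (norm_nonneg ω) hωn).comp (tendsto_add_atTop_nat 1)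
  have h2 : Tendsto (fun k : ℕ => ‖((dq ω v) ^ (k + 1)).snd‖) atTop (nhds 0) := by
    have a := tendsto_self_mul_const_pow_of_lt_one (norm_nonneg ω) hωn
    have b := tendsto_pow_atTop_nhds_zero_of_lt_one (norm_nonneg ω) hωn
    have c := (a.add b).mul_const ‖v‖
    simp only [add_zero, zero_mul] at c
    refine squeeze_zero (fun _ => norm_nonneg _) (fun k => ?_) c
    refine (dq_pow_snd_norm ω v k).trans (le_of_eq ?_)
    ring
  rw [← tendsto_add_atTop_iff_nat 1]
  have h3 := ((h1.pow 2).add (h2.pow 2)).sqrt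
  simpa [dualQuatNorm] using h3
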